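/- Let V ⊆ ℂ^k be a connected open set. Let H, H_1, …, H_{κ₁+κ₂} be Nash algebraic holomorphic functions on V, each nowhere vanishing on V, and let u, u_1, …, u_{κ₁+κ₂} be holomorphic functions on V with exp(u) = H and exp(u_j) = H_j on V (holomorphic branches of the logarithms). Let μ, μ_1, …, μ_{κ₁+κ₂} be non-zero real numbers, and let P, Q be one-variable polynomials with real coefficients. Set A(ξ) = exp(Σ_{j=1}^{κ₁} μ_j u_j(ξ)) (so A = ∏_{j=1}^{κ₁} H_j^{μ_j}) and B(ξ) = exp(Σ_{j=κ₁+1}^{κ₁+κ₂} μ_j u_j(ξ)), and assume Q(A(ξ)) ≠ 0 for all ξ ∈ V. If P(A(ξ)) · B(ξ) / Q(A(ξ)) = exp( exp(μ · u(ξ)) ) for all ξ ∈ V, then H is constant on V. (Lemma 2.6, case (10): R(∏ H_j^{μ_j}) ∏ H_j^{μ_j} = exp{H^μ} forces H constant.) -/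

import Mathlib

open scoped BigOperators

/-- A holomorphic function `f` on an open set `V ⊆ ℂ^k` is *Nash algebraic* if there is a
nonzero polynomial `P` in the variables `(z₁, …, z_k, y)` with complex coefficients such that
`P(z, f z) = 0` for all `z ∈ V`. -/
def NashAlgebraicOn {k : ℕ} (f : (Fin k → ℂ) → ℂ) (V : Set (Fin k → ℂ)) : Prop :=
  ∃ P : MvPolynomial (Fin k ⊕ Unit) ℂ, P ≠ 0 ∧
    ∀ z ∈ V, MvPolynomial.eval (Sum.elim z fun _ => f z) P = 0

section

open Polynomial IntermediateField
open Differential (mapCoeffs implicitDeriv)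
open scoped Differential

/-- Taking norms: a combination of logarithmic derivatives that lies in the base field is, up to a
positive integer multiple, a combination of logarithmic derivatives of elements of the base. -/
lemma exists_nat_mul_eq_sum_logDeriv_of_isGalois {F K ι : Type*} [Field F] [Field K]
    [Differential F] [Differential K] [Algebra F K] [DifferentialAlgebra F K] [CharZero F]
    [FiniteDimensional F K] [IsGalois F K] [Fintype ι] (a : F) (c : ι → F) (u : ι → K)
    (h : algebraMap F K a = ∑ i, algebraMap F K (c i) * Differential.logDeriv (u i)) :
    ∃ (n : ℕ) (v : ι → F), n ≠ 0 ∧ n * a = ∑ i, c i * Differential.logDeriv (v i) := by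
  have key : ∀ i, ∃ v : F, algebraMap F K v = ∏ σ : (K ≃ₐ[F] K), σ (u i) := by
    intro i
    apply (IsGalois.mem_range_algebraMap_iff_fixed _).2
    intro e
    rw [map_prod]
    exact Fintype.prod_equiv (Equiv.mulLeft e) _ _ (by simp)
  choose v hv using key
  refine ⟨Fintype.card (K ≃ₐ[F] K), v, Fintype.card_ne_zero, ?_⟩
  apply (algebraMap F K).injective
  have hlog : ∀ i, algebraMap F K (Differential.logDeriv (v i)) =
      ∑ σ : (K ≃ₐ[F] K), Differential.logDeriv (σ (u i)) := by
    intro i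
    rw [← Differential.logDeriv_algebraMap, hv]
    by_cases hu : u i = 0
    · simp [hu]
    · exact Differential.logDeriv_prod _ _ _ (by simp [hu])
  simp only [map_mul, map_sum, map_natCast, hlog, Finset.mul_sum]
  rw [Finset.sum_comm]
  trans ∑ σ : (K ≃ₐ[F] K), algebraMap F K a
  · simp
  · refine Finset.sum_congr rfl fun σ _ => ?_
    have := congrArg σ h
    simpa [Differential.logDeriv, Differential.algEquiv_deriv'] using this

lemma exists_nat_mul_eq_sum_logDeriv {F L ι : Type*} [Field F] [Field L]
    [Differential F] [Differential L] [Algebra F L] [DifferentialAlgebra F L] [CharZero F]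
    [Fintype ι] (a : F) (c : ι → F) (u : ι → L) (hu : ∀ i, IsAlgebraic F (u i))
    (h : algebraMap F L a = ∑ i, algebraMap F L (c i) * Differential.logDeriv (u i)) :
    ∃ (n : ℕ) (v : ι → F), n ≠ 0 ∧ n * a = ∑ i, c i * Differential.logDeriv (v i) := by
  let M : IntermediateField F L := adjoin F (Set.range u)
  have : FiniteDimensional F M :=
    finiteDimensional_adjoin (by rintro _ ⟨i, rfl⟩; exact (hu i).isIntegral)
  let N : IntermediateField F (AlgebraicClosure F) := normalClosure F M (AlgebraicClosure F)
  let φ₀ : M →ₐ[F] AlgebraicClosure F := IsAlgClosed.lift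
  let φ : M →ₐ[F] N := φ₀.codRestrict N.toSubalgebra
    (fun x => φ₀.fieldRange_le_normalClosure ⟨x, rfl⟩)
  have : FiniteDimensional F N := normalClosure.is_finiteDimensional F M _
  have : IsGalois F N := {}
  let w : ι → M := fun i => ⟨u i, subset_adjoin F _ ⟨i, rfl⟩⟩
  refine exists_nat_mul_eq_sum_logDeriv_of_isGalois a c (fun i => φ (w i)) ?_
  have hM : algebraMap F M a = ∑ i, algebraMap F M (c i) * Differential.logDeriv (w i) := by
    apply (algebraMap M L).injective
    simp only [map_sum, map_mul, ← Differential.logDeriv_algebraMap,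
      ← IsScalarTower.algebraMap_apply, h]
    rfl
  have := congrArg φ hM
  simp only [map_sum, map_mul, AlgHom.commutes] at this
  rw [this]
  refine Finset.sum_congr rfl fun i _ => ?_
  simp [Differential.logDeriv, Differential.algHom_deriv' φ φ.injective]

lemma mem_matroid_closure_iff_isAlgebraic_adjoin {k L : Type*} [Field k] [Field L] [Algebra k L]
    {s : Set L} {x : L} : x ∈ (AlgebraicIndependent.matroid k L).closure s ↔
      IsAlgebraic (IntermediateField.adjoin k s) x := by
  rw [AlgebraicIndependent.matroid_closure_eq, IntermediateField.isAlgebraic_adjoin_iff]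
  rfl

lemma IsAlgebraic.adjoin_simple_trans {k L : Type*} [Field k] [Field L] [Algebra k L] {x y w : L}
    (hw : IsAlgebraic k⟮y⟯ w) (hy : IsAlgebraic k⟮x⟯ y) : IsAlgebraic k⟮x⟯ w := by
  rw [← mem_matroid_closure_iff_isAlgebraic_adjoin] at hw hy ⊢
  exact Matroid.closure_subset_closure_of_subset_closure (Set.singleton_subset_iff.2 hy) hw

lemma Transcendental.isAlgebraic_adjoin_simple_exchange {k L : Type*} [Field k] [Field L]
    [Algebra k L] {x y : L} (hx : Transcendental k x) (hxy : IsAlgebraic k⟮y⟯ x) :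
    IsAlgebraic k⟮x⟯ y := by
  have hx0 : x ∉ (AlgebraicIndependent.matroid k L).closure ∅ := fun h => by
    have : Algebra.IsAlgebraic k (IntermediateField.adjoin k (∅ : Set L)) :=
      isAlgebraic_adjoin (by simp)
    exact hx ((mem_matroid_closure_iff_isAlgebraic_adjoin.1 h).restrictScalars k)
  rw [← mem_matroid_closure_iff_isAlgebraic_adjoin, ← insert_empty_eq] at hxy ⊢
  exact (Matroid.closure_exchange ⟨hxy, hx0⟩).1

lemma deriv_mem_adjoin_simple {K L : Type*} [Field K] [Field L] [Differential K]
    [Differential L] [Algebra K L] [DifferentialAlgebra K L] {h : L} {η : K[X]}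
    (hη : h′ = aeval h η) {x : L} (hx : x ∈ K⟮h⟯) : x′ ∈ K⟮h⟯ := by
  obtain ⟨p, q, rfl⟩ := (mem_adjoin_simple_iff K x).1 hx
  have hp (p : K[X]) : aeval h p ∈ K⟮h⟯ :=
    algebra_adjoin_le_adjoin K _ (aeval_mem_adjoin_singleton K h)
  rw [Derivation.leibniz_div, Differential.deriv_aeval_eq_implicitDeriv h η hη,
    Differential.deriv_aeval_eq_implicitDeriv h η hη]
  simp only [smul_eq_mul]
  exact mul_mem (pow_mem (inv_mem (hp _)) 2)
    (sub_mem (mul_mem (hp _) (hp _)) (mul_mem (hp _) (hp _)))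

/-- The restriction of a derivation to a stable intermediate field. -/
@[reducible]
noncomputable def IntermediateField.differential {K L : Type*} [Field K] [Field L] [Differential L]
    [Algebra K L] (E : IntermediateField K L) (hE : ∀ x ∈ E, x′ ∈ E) : Differential E where
  deriv := Derivation.mk'
    { toFun := fun x => ⟨(x : L)′, hE x x.2⟩
      map_add' := fun x y => by ext; simp
      map_smul' := fun n x => by ext; simp }
    (fun x y => by ext; simp)

/-- The quotients `M(h) / W(h)` with `deg M < deg W + deg η`, as a `K`-subspace of `L`. -/
def quotientsOfDegreeLT {K L : Type*} [Field K] [Field L] [Algebra K L] (h : L) {η : K[X]}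
    (hη0 : η ≠ 0) : Submodule K L where
  carrier := {x | ∃ M W : K[X], W ≠ 0 ∧ x * aeval h W = aeval h M ∧
    M.degree < W.degree + η.degree}
  zero_mem' := ⟨0, 1, one_ne_zero, by simp, by
    rw [degree_zero, degree_one, zero_add]; exact bot_lt_iff_ne_bot.2 (degree_ne_bot.2 hη0)⟩
  add_mem' := by
    rintro x y ⟨M₁, W₁, h₁, e₁, d₁⟩ ⟨M₂, W₂, h₂, e₂, d₂⟩
    refine ⟨M₁ * W₂ + M₂ * W₁, W₁ * W₂, mul_ne_zero h₁ h₂, ?_, ?_⟩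
    · simp only [map_add, map_mul, ← e₁, ← e₂]; ring
    · refine (degree_add_le _ _).trans_lt (max_lt ?_ ?_)
      · rw [degree_mul, degree_mul, add_right_comm]
        exact WithBot.add_lt_add_right (degree_ne_bot.2 h₂) d₁
      · rw [degree_mul, degree_mul, add_comm W₁.degree, add_right_comm]
        exact WithBot.add_lt_add_right (degree_ne_bot.2 h₁) d₂
  smul_mem' := by
    rintro c x ⟨M, W, hW, e, d⟩
    refine ⟨c • M, W, hW, ?_, (degree_smul_le _ _).trans_lt d⟩
    rw [map_smul, ← e, smul_mul_assoc]

lemma logDeriv_mem_quotientsOfDegreeLT {K L : Type*} [Field K] [Field L] [Differential K]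
    [Differential L] [Algebra K L] [DifferentialAlgebra K L] {h : L} {η : K[X]}
    (hη : h′ = aeval h η) (hη0 : η ≠ 0)
    (hdeg : ∀ f : K[X], f ≠ 0 → (implicitDeriv η f).degree < f.degree + η.degree)
    {x : L} (hx : x ∈ K⟮h⟯) : Differential.logDeriv x ∈ quotientsOfDegreeLT h hη0 := by
  have hpoly (p : K[X]) (hp : aeval h p ≠ 0) :
      Differential.logDeriv (aeval h p) ∈ quotientsOfDegreeLT h hη0 := by
    have hp0 : p ≠ 0 := by rintro rfl; simp at hp
    refine ⟨implicitDeriv η p, p, hp0, ?_, hdeg p hp0⟩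
    rw [Differential.logDeriv, div_mul_cancel₀ _ hp,
      Differential.deriv_aeval_eq_implicitDeriv h η hη]
  obtain ⟨p, q, rfl⟩ := (mem_adjoin_simple_iff K x).1 hx
  by_cases hp : aeval h p = 0
  · simp [hp]
  by_cases hq : aeval h q = 0
  · simp [hq]
  rw [Differential.logDeriv_div _ _ hp hq]
  exact sub_mem (hpoly p hp) (hpoly q hq)

/-- If `h` is transcendental over `K` with `h′ = η(h)`, and the derivation lowers degrees in `h`
relative to `η`, then `h′` is not a `K`-combination of logarithmic derivatives of elements algebraic
over `K(h)`. -/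
lemma deriv_notMem_span_logDeriv {K L : Type*} [Field K] [Field L] [Differential K]
    [Differential L] [Algebra K L] [DifferentialAlgebra K L] [CharZero K] {h : L} {η : K[X]}
    (hη : h′ = aeval h η) (hη0 : η ≠ 0) (hh : Transcendental K h)
    (hdeg : ∀ f : K[X], f ≠ 0 → (implicitDeriv η f).degree < f.degree + η.degree) :
    h′ ∉ Submodule.span K (Differential.logDeriv '' {f : L | IsAlgebraic K⟮h⟯ f}) := by
  intro hmem
  let : Differential K⟮h⟯ := IntermediateField.differential _ fun x => deriv_mem_adjoin_simple hη
  have : DifferentialAlgebra K⟮h⟯ L := ⟨fun a => rfl⟩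
  have : CharZero K⟮h⟯ := charZero_of_injective_algebraMap (algebraMap K K⟮h⟯).injective
  obtain ⟨m, c, g, hsum⟩ := Submodule.mem_span_set'.1 hmem
  choose f hf hfg using fun i => (g i).2
  have hh' : h′ ∈ K⟮h⟯ := deriv_mem_adjoin_simple hη (mem_adjoin_simple_self K h)
  obtain ⟨n, v, hn, hv⟩ := exists_nat_mul_eq_sum_logDeriv (⟨h′, hh'⟩ : K⟮h⟯)
    (fun i => algebraMap K K⟮h⟯ (c i)) f hf (by
      change h′ = _
      rw [← hsum]
      refine Finset.sum_congr rfl fun i _ => ?_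
      rw [hfg, Algebra.smul_def]
      rfl)
  have hmem' : n • h′ ∈ quotientsOfDegreeLT h hη0 := by
    have := congrArg (algebraMap K⟮h⟯ L) hv
    simp only [map_mul, map_natCast, map_sum, ← Differential.logDeriv_algebraMap,
      ← IsScalarTower.algebraMap_apply] at this
    rw [nsmul_eq_mul]
    erw [this]
    refine sum_mem fun i _ => ?_
    rw [← Algebra.smul_def]
    exact Submodule.smul_mem _ _ (logDeriv_mem_quotientsOfDegreeLT hη hη0 hdeg (v i).2)
  obtain ⟨M, W, hW, e, d⟩ := hmem'
  have e' : (n : K[X]) * η * W = M := by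
    apply transcendental_iff_injective.1 hh
    rw [← e, hη]
    simp [nsmul_eq_mul]
  have hnK : (n : K[X]) = C (n : K) := by simp
  rw [← e', hnK, degree_mul, degree_C_mul (Nat.cast_ne_zero.2 hn), add_comm] at d
  exact lt_irrefl _ d

/-- If `h′ = 1` over a field `k` of constants, then `h′` is not a `k`-combination of logarithmic
derivatives of elements algebraic over `k(h)`. -/
lemma deriv_notMem_span_logDeriv_of_deriv_eq_one {k L : Type*} [Field k] [Field L]
    [Differential L] [Algebra k L] [CharZero k] (hk : ∀ c : k, (algebraMap k L c)′ = 0) {h : L}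
    (h1 : h′ = 1) (hh : Transcendental k h) :
    h′ ∉ Submodule.span k (Differential.logDeriv '' {f : L | IsAlgebraic k⟮h⟯ f}) := by
  let : Differential k := ⟨0⟩
  have : DifferentialAlgebra k L := ⟨fun c => by rw [hk]; exact (map_zero _).symm⟩
  refine deriv_notMem_span_logDeriv (η := 1) (by simpa using h1) one_ne_zero hh fun f hf => ?_
  have hmap : mapCoeffs f = 0 := by ext i; simp; rfl
  have : implicitDeriv 1 f = derivative f := by simp [implicitDeriv, hmap]
  rw [this, degree_one, add_zero]
  exact degree_derivative_lt hf

/-- An element with nonzero derivative is transcendental over any field of constants. -/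
lemma transcendental_of_deriv_ne_zero {k L : Type*} [Field k] [Field L]
    [Differential L] [Algebra k L] [CharZero k] (hk : ∀ c : k, (algebraMap k L c)′ = 0) {h : L}
    (h0 : h′ ≠ 0) : Transcendental k h := by
  intro halg
  let : Differential k := ⟨0⟩
  have : DifferentialAlgebra k L := ⟨fun c => by rw [hk]; exact (map_zero _).symm⟩
  have hmap : mapCoeffs (minpoly k h) = 0 := by ext i; simp; rfl
  have := Differential.deriv_aeval_eq h (minpoly k h)
  rw [minpoly.aeval, map_zero, hmap, map_zero, zero_add] at this
  refine (mul_ne_zero ?_ h0) this.symm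
  exact (minpoly.irreducible halg.isIntegral).separable.aeval_derivative_ne_zero
    (minpoly.aeval k h)

/-- If `h` is algebraic over `k(z)` and `h′` is a `k`-combination of logarithmic derivatives of
elements algebraic over `k(z)`, then `h` is constant. -/
lemma deriv_eq_zero_of_mem_span_logDeriv {k L : Type*} [Field k] [Field L]
    [Differential L] [Algebra k L] [CharZero k] (hk : ∀ c : k, (algebraMap k L c)′ = 0) {z h : L}
    (hh : IsAlgebraic k⟮z⟯ h)
    (hspan : h′ ∈ Submodule.span k (Differential.logDeriv '' {f : L | IsAlgebraic k⟮z⟯ f})) :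
    h′ = 0 := by
  by_contra h0
  have htr := transcendental_of_deriv_ne_zero hk h0
  have hz := htr.isAlgebraic_adjoin_simple_exchange hh
  have := @deriv_notMem_span_logDeriv_of_deriv_eq_one k L _ _ ⟨(h′)⁻¹ • Differential.deriv⟩ _ _
    (fun c => by
      change (h′)⁻¹ * (algebraMap k L c)′ = 0
      rw [hk, mul_zero]) h (inv_mul_cancel₀ h0) htr
  apply this
  change (h′)⁻¹ * h′ ∈ _
  have hmem := Submodule.mem_map_of_mem (f := LinearMap.mulLeft k (h′)⁻¹) hspan
  rw [Submodule.map_span] at hmem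
  refine Submodule.span_mono ?_ hmem
  rintro _ ⟨_, ⟨f, hf, rfl⟩, rfl⟩
  refine ⟨f, IsAlgebraic.adjoin_simple_trans hf hz, ?_⟩
  change (h′)⁻¹ * f′ / f = (h′)⁻¹ * (f′ / f)
  rw [mul_div_assoc]

/-- If `h` is transcendental over `K` with `h′ = a h`, `a ≠ 0`, then `h′` is not a `K`-combination
of logarithmic derivatives of elements algebraic over `K(h)`. -/
lemma deriv_notMem_span_logDeriv_of_exponential {K L : Type*} [Field K] [Field L] [Differential K]
    [Differential L] [Algebra K L] [DifferentialAlgebra K L] [CharZero K] {h : L} {a : K}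
    (ha : a ≠ 0) (hah : h′ = algebraMap K L a * h) (hh : Transcendental K h) :
    h′ ∉ Submodule.span K (Differential.logDeriv '' {f : L | IsAlgebraic K⟮h⟯ f}) := by
  refine deriv_notMem_span_logDeriv (η := C a * X) (by simpa using hah)
    (mul_ne_zero (C_ne_zero.2 ha) X_ne_zero) hh fun f hf => ?_
  rw [degree_C_mul_X ha]
  have hle : (implicitDeriv (C a * X) f).degree ≤ f.degree := by
    refine (degree_le_iff_coeff_zero _ _).2 fun n hn => ?_
    have hn' : f.coeff n = 0 := coeff_eq_zero_of_degree_lt hn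
    cases n with
    | zero => simp [implicitDeriv, hn', mul_assoc]
    | succ n => simp [implicitDeriv, hn', mul_assoc, coeff_derivative]
  refine hle.trans_lt ?_
  rw [degree_eq_natDegree hf]
  exact_mod_cast Nat.lt_succ_self _

lemma IsAlgebraic.deriv {F L : Type*} [Field F] [Field L] [Differential F] [Differential L]
    [Algebra F L] [DifferentialAlgebra F L] [CharZero F] {x : L} (hx : IsAlgebraic F x) :
    IsAlgebraic F x′ := by
  have : FiniteDimensional F F⟮x⟯ := adjoin.finiteDimensional hx.isIntegral
  have h1 : x′ = algebraMap F⟮x⟯ L (AdjoinSimple.gen F x)′ := by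
    rw [← DifferentialAlgebra.deriv_algebraMap, AdjoinSimple.algebraMap_gen]
  rw [h1]
  exact (Algebra.IsAlgebraic.isAlgebraic (AdjoinSimple.gen F x)′).algebraMap

/-- A rational function `p / q` with constant coefficients and neither zero nor pole at the origin,
evaluated at a transcendental exponential element `A`, has logarithmic derivative in the base field
only if this logarithmic derivative vanishes. -/
lemma eq_zero_of_eq_logDeriv_aeval_sub {K L : Type*} [Field K] [Field L] [Differential K]
    [Differential L] [Algebra K L] [DifferentialAlgebra K L] {A : L} {α s : K}
    (hA : Transcendental K A) (hα : A′ = algebraMap K L α * A) {p q : K[X]}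
    (hp : mapCoeffs p = 0) (hq : mapCoeffs q = 0) (hp0 : p.eval 0 ≠ 0) (hq0 : q.eval 0 ≠ 0)
    (hs : algebraMap K L s =
      Differential.logDeriv (aeval A p) - Differential.logDeriv (aeval A q)) : s = 0 := by
  have hinj := transcendental_iff_injective.1 hA
  have hne (p : K[X]) (hp0 : p.eval 0 ≠ 0) : aeval A p ≠ 0 := by
    intro h
    apply hp0
    rw [hinj (h.trans (map_zero _).symm), eval_zero]
  have hpA := hne p hp0
  have hqA := hne q hq0
  have key : C s * p * q = C α * X * (derivative p * q - p * derivative q) := by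
    apply hinj
    simp only [map_mul, map_sub, aeval_C, aeval_X]
    rw [hs, Differential.logDeriv, Differential.logDeriv, Differential.deriv_aeval_eq,
      Differential.deriv_aeval_eq, hp, hq, hα]
    simp only [map_zero, zero_add]
    field_simp
  have := congrArg (eval 0) key
  simpa [hp0, hq0] using this

lemma IsAlgebraic.aeval_self {F L : Type*} [Field F] [Field L] [Algebra F L] {x : L}
    (hx : IsAlgebraic F x) (p : F[X]) : IsAlgebraic F (aeval x p) := by
  have : F⟮x⟯ ≤ algebraicClosure F L := by
    rw [adjoin_simple_le_iff]
    exact mem_algebraicClosure_iff.2 hx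
  exact mem_algebraicClosure_iff.1
    (this (algebra_adjoin_le_adjoin F _ (aeval_mem_adjoin_singleton F x)))

/-- If `P(A) B / Q(A) = E` with `A` transcendental exponential over `K`, `P`, `Q` with constant
coefficients, and `B`, `E` having logarithmic derivatives in `K`, then the logarithmic derivatives
of `A`, `B`, `E` are related by an integral relation. -/
lemma exists_logDeriv_eq_add_intCast_mul {K L : Type*} [Field K] [Field L] [Differential K]
    [Differential L] [Algebra K L] [DifferentialAlgebra K L] {A B E : L} {α β ε : K} {P Q : K[X]}
    (hA : Transcendental K A) (hP : mapCoeffs P = 0) (hQ : mapCoeffs Q = 0)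
    (hα : Differential.logDeriv A = algebraMap K L α) (hB0 : B ≠ 0) (hE0 : E ≠ 0)
    (hβ : Differential.logDeriv B = algebraMap K L β)
    (hε : Differential.logDeriv E = algebraMap K L ε)
    (hQA : aeval A Q ≠ 0) (heq : aeval A P * B = E * aeval A Q) :
    ∃ n : ℤ, ε = β + n * α := by
  have hA0 : A ≠ 0 := fun h => hA (h ▸ isAlgebraic_zero)
  have hPA : aeval A P ≠ 0 := by
    intro h
    rw [h, zero_mul] at heq
    exact mul_ne_zero hE0 hQA heq.symm
  have factor (p : K[X]) (hp : mapCoeffs p = 0) (hpA : aeval A p ≠ 0) :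
      ∃ (q : K[X]) (n : ℕ), p = X ^ n * q ∧ mapCoeffs q = 0 ∧ q.eval 0 ≠ 0 := by
    have hp0 : p ≠ 0 := by rintro rfl; simp at hpA
    obtain ⟨q, hq, hq0⟩ := exists_eq_pow_rootMultiplicity_mul_and_not_dvd p hp0 0
    rw [C_0, sub_zero] at hq hq0
    refine ⟨q, _, hq, ?_, fun h => hq0 (X_dvd_iff.2 ?_)⟩
    · ext i
      have := congrArg (fun r => coeff r (i + p.rootMultiplicity 0)) hp
      generalize p.rootMultiplicity 0 = n at hq this
      simpa [hq] using this
    · rwa [coeff_zero_eq_eval_zero]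
  obtain ⟨p, m, rfl, hp, hp0⟩ := factor P hP hPA
  obtain ⟨q, n, rfl, hq, hq0⟩ := factor Q hQ hQA
  simp only [map_mul, map_pow, aeval_X] at heq hPA hQA
  have hpA := right_ne_zero_of_mul hPA
  have hqA := right_ne_zero_of_mul hQA
  have hlog := congrArg Differential.logDeriv heq
  rw [Differential.logDeriv_mul _ _ hPA hB0, Differential.logDeriv_mul _ _ hE0 hQA,
    Differential.logDeriv_mul _ _ (pow_ne_zero _ hA0) hpA,
    Differential.logDeriv_mul _ _ (pow_ne_zero _ hA0) hqA, Differential.logDeriv_pow,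
    Differential.logDeriv_pow, hα, hβ, hε] at hlog
  have hα' : A′ = algebraMap K L α * A := by
    rw [← hα, Differential.logDeriv, div_mul_cancel₀ _ hA0]
  refine ⟨m - n, ?_⟩
  have := eq_zero_of_eq_logDeriv_aeval_sub (s := ε - β - (m - n) * α) hA hα' hp hq hp0 hq0 (by
    simp only [map_sub, map_mul, map_natCast]
    linear_combination - hlog)
  push_cast
  linear_combination this

/-- If `P(A) B / Q(A) = E` with `A`, `B` exponential over `K` and the logarithmic derivative of `E`
is the derivative of `h`, where `h` is itself exponential and transcendental over `K`, then
`h` is constant. -/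
lemma deriv_eq_zero_of_transcendental_of_exponential {K L : Type*} [Field K] [Field L]
    [Differential K] [Differential L] [Algebra K L] [DifferentialAlgebra K L] [CharZero K]
    {h A B E : L} {a α β : K} {P Q : K[X]} (hh : Transcendental K h)
    (hah : h′ = algebraMap K L a * h)
    (hα : Differential.logDeriv A = algebraMap K L α) (hA0 : A ≠ 0) (hB0 : B ≠ 0) (hE0 : E ≠ 0)
    (hβ : Differential.logDeriv B = algebraMap K L β) (hE : Differential.logDeriv E = h′)
    (hQA : aeval A Q ≠ 0) (heq : aeval A P * B = E * aeval A Q) : h′ = 0 := by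
  by_cases ha : a = 0
  · rw [hah, ha, map_zero, zero_mul]
  have hh0 : h ≠ 0 := fun h0 => hh (h0 ▸ isAlgebraic_zero)
  exfalso
  have hPA : aeval A P ≠ 0 := by
    intro h
    rw [h, zero_mul] at heq
    exact mul_ne_zero hE0 hQA heq.symm
  have hlog := congrArg Differential.logDeriv heq
  rw [Differential.logDeriv_mul _ _ hPA hB0, Differential.logDeriv_mul _ _ hE0 hQA, hE, hβ] at hlog
  have hα' : A′ = aeval A (C α * X) := by
    rw [map_mul, aeval_C, aeval_X, ← hα, Differential.logDeriv, div_mul_cancel₀ _ hA0]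
  have hmem (p : K[X]) : aeval A p ∈ K⟮A⟯ :=
    algebra_adjoin_le_adjoin K _ (aeval_mem_adjoin_singleton K A)
  have hlogmem (p : K[X]) : Differential.logDeriv (aeval A p) ∈ K⟮A⟯ :=
    div_mem (deriv_mem_adjoin_simple hα' (hmem p)) (hmem p)
  have ha' : algebraMap K L a ≠ 0 := (_root_.map_ne_zero _).2 ha
  have hhA : h ∈ K⟮A⟯ := by
    have : h = (algebraMap K L a)⁻¹ * (Differential.logDeriv (aeval A P) + algebraMap K L β -
        Differential.logDeriv (aeval A Q)) := by
      rw [hlog, add_sub_cancel_right, hah, inv_mul_cancel_left₀ ha']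
    rw [this]
    exact mul_mem (inv_mem (IntermediateField.algebraMap_mem _ _))
      (sub_mem (add_mem (hlogmem P) (IntermediateField.algebraMap_mem _ _)) (hlogmem Q))
  have hAh : IsAlgebraic K⟮h⟯ A := hh.isAlgebraic_adjoin_simple_exchange
    (isAlgebraic_algebraMap (⟨h, hhA⟩ : K⟮A⟯))
  have hpoly (p : K[X]) : IsAlgebraic K⟮h⟯ (aeval A p) := by
    rw [← aeval_map_algebraMap K⟮h⟯]
    exact hAh.aeval_self _
  refine deriv_notMem_span_logDeriv_of_exponential ha hah hh ?_
  have hβ' : algebraMap K L β = (β / a) • Differential.logDeriv h := by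
    rw [Differential.logDeriv, hah, mul_div_assoc, div_self hh0, mul_one, Algebra.smul_def,
      ← map_mul, div_mul_cancel₀ _ ha]
  have : h′ = Differential.logDeriv (aeval A P) + (β / a) • Differential.logDeriv h -
      Differential.logDeriv (aeval A Q) := by
    rw [← hβ', hlog, add_sub_cancel_right]
  rw [this]
  refine sub_mem (add_mem (Submodule.subset_span ⟨_, hpoly P, rfl⟩)
    (Submodule.smul_mem _ _ (Submodule.subset_span ⟨h, ?_, rfl⟩)))
    (Submodule.subset_span ⟨_, hpoly Q, rfl⟩)
  exact isAlgebraic_algebraMap (⟨h, mem_adjoin_simple_self K h⟩ : K⟮h⟯)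

/-- Over the rational functions in `z`, where `z′ = 1`, an identity
`P(A) B / Q(A) = exp h` with `A`, `B` products of complex powers of algebraic elements and `h`
exponential with algebraic exponent forces `h` to be constant. -/
theorem deriv_eq_zero_of_aeval_mul_eq_exp_mul {k L : Type*} [Field k] [Field L] [Differential L]
    [Algebra k L] [CharZero k] (hk : ∀ c : k, (algebraMap k L c)′ = 0) {z : L} (hz : z′ = 1)
    {a h A B E : L} {P Q : k[X]}
    (ha : a ∈ Submodule.span k (Differential.logDeriv '' {f : L | IsAlgebraic k⟮z⟯ f}))
    (hah : h′ = a * h)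
    (hA0 : A ≠ 0) (hB0 : B ≠ 0) (hE0 : E ≠ 0)
    (hA : Differential.logDeriv A ∈
      Submodule.span k (Differential.logDeriv '' {f : L | IsAlgebraic k⟮z⟯ f}))
    (hB : Differential.logDeriv B ∈
      Submodule.span k (Differential.logDeriv '' {f : L | IsAlgebraic k⟮z⟯ f}))
    (hE : Differential.logDeriv E = h′)
    (hQA : aeval A Q ≠ 0) (heq : aeval A P * B = E * aeval A Q) : h′ = 0 := by
  let : Differential k := ⟨0⟩
  have : DifferentialAlgebra k L := ⟨fun c => by rw [hk]; exact (map_zero _).symm⟩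
  let : Differential k⟮z⟯ := IntermediateField.differential _
    fun x => deriv_mem_adjoin_simple (η := (1 : k[X])) (by simpa using hz)
  have : DifferentialAlgebra k⟮z⟯ L := ⟨fun a => rfl⟩
  have : CharZero k⟮z⟯ := charZero_of_injective_algebraMap (algebraMap k k⟮z⟯).injective
  let K := algebraicClosure k⟮z⟯ L
  have hKmem {x : L} : x ∈ K ↔ IsAlgebraic k⟮z⟯ x := mem_algebraicClosure_iff
  let : Differential K := IntermediateField.differential _
    fun x hx => hKmem.2 (hKmem.1 hx).deriv
  have : DifferentialAlgebra K L := ⟨fun a => rfl⟩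
  have : CharZero K := charZero_of_injective_algebraMap (algebraMap k⟮z⟯ K).injective
  have hKalg {x : L} (hx : IsAlgebraic K x) : IsAlgebraic k⟮z⟯ x := hx.restrictScalars _
  have hspan {x : L} (hx : x ∈ Submodule.span k
      (Differential.logDeriv '' {f : L | IsAlgebraic k⟮z⟯ f})) : x ∈ K := by
    induction hx using Submodule.span_induction with
    | mem x hx =>
      obtain ⟨f, hf, rfl⟩ := hx
      exact div_mem (hKmem.2 (IsAlgebraic.deriv hf)) (hKmem.2 hf)
    | zero => exact zero_mem _
    | add x y _ _ hx hy => exact add_mem hx hy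
    | smul c x _ hx =>
      rw [Algebra.smul_def]
      exact mul_mem (IntermediateField.algebraMap_mem K (algebraMap k k⟮z⟯ c)) hx
  have : IsScalarTower k K L := IsScalarTower.of_algebraMap_eq' rfl
  have hmapK (p : k[X]) : mapCoeffs (p.map (algebraMap k K)) = 0 := by
    ext i
    rw [Differential.coeff_mapCoeffs, coeff_map]
    exact hk _
  have haev (p : k[X]) : aeval A (p.map (algebraMap k K)) = aeval A p := aeval_map_algebraMap _ _ _
  by_cases hh : IsAlgebraic K h
  · have hhz := hKalg hh
    apply deriv_eq_zero_of_mem_span_logDeriv hk hhz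
    by_cases hAalg : IsAlgebraic K A
    · have hPA : aeval A P ≠ 0 := by
        intro h
        rw [h, zero_mul] at heq
        exact mul_ne_zero hE0 hQA heq.symm
      have hlog := congrArg Differential.logDeriv heq
      rw [Differential.logDeriv_mul _ _ hPA hB0, Differential.logDeriv_mul _ _ hE0 hQA, hE] at hlog
      rw [← sub_eq_of_eq_add hlog]
      have hpoly (p : k[X]) : IsAlgebraic k⟮z⟯ (aeval A p) := by
        rw [← aeval_map_algebraMap k⟮z⟯]
        exact (hKalg hAalg).aeval_self _
      exact sub_mem (add_mem (Submodule.subset_span ⟨_, hpoly P, rfl⟩) hB)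
        (Submodule.subset_span ⟨_, hpoly Q, rfl⟩)
    · obtain ⟨n, hn⟩ := exists_logDeriv_eq_add_intCast_mul
        (α := (⟨_, hspan hA⟩ : K)) (β := (⟨_, hspan hB⟩ : K))
        (ε := (⟨h′, hKmem.2 hhz.deriv⟩ : K)) hAalg (hmapK P) (hmapK Q) rfl hB0 hE0 rfl hE
        (by rwa [haev]) (by rwa [haev, haev])
      have := congrArg (algebraMap K L) hn
      rw [map_add, map_mul, map_intCast] at this
      change h′ = Differential.logDeriv B + n * Differential.logDeriv A at this
      rw [this, ← zsmul_eq_mul]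
      exact add_mem hB (zsmul_mem hA n)
  · exact deriv_eq_zero_of_transcendental_of_exponential (a := (⟨a, hspan ha⟩ : K))
      (α := (⟨_, hspan hA⟩ : K)) (β := (⟨_, hspan hB⟩ : K)) (P := P.map (algebraMap k K))
      (Q := Q.map (algebraMap k K)) hh hah rfl hA0 hB0 hE0 rfl hE
      (by rwa [haev]) (by rwa [haev, haev])

open Filter Topology

/-- The subring of germs at `0` of meromorphic functions of one complex variable. -/
def meromorphicGermSubring : Subring (Germ (𝓝[≠] (0 : ℂ)) ℂ) where
  carrier := {g | ∃ f : ℂ → ℂ, MeromorphicAt f 0 ∧ (f : Germ (𝓝[≠] (0 : ℂ)) ℂ) = g}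
  mul_mem' := by
    rintro _ _ ⟨f, hf, rfl⟩ ⟨g, hg, rfl⟩
    exact ⟨f * g, hf.mul hg, rfl⟩
  one_mem' := ⟨1, MeromorphicAt.const 1 0, rfl⟩
  add_mem' := by
    rintro _ _ ⟨f, hf, rfl⟩ ⟨g, hg, rfl⟩
    exact ⟨f + g, hf.add hg, rfl⟩
  zero_mem' := ⟨0, MeromorphicAt.const 0 0, rfl⟩
  neg_mem' := by
    rintro _ ⟨f, hf, rfl⟩
    exact ⟨-f, hf.neg, rfl⟩

/-- The field of germs at `0` of meromorphic functions of one complex variable. -/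
def MeromorphicGerm : Type := meromorphicGermSubring

namespace MeromorphicGerm

noncomputable instance : CommRing MeromorphicGerm :=
  inferInstanceAs (CommRing meromorphicGermSubring)

/-- The germ of a meromorphic function. -/
noncomputable def mk (f : ℂ → ℂ) (hf : MeromorphicAt f 0) : MeromorphicGerm :=
  ⟨(f : Germ _ ℂ), f, hf, rfl⟩

variable {f g : ℂ → ℂ} {hf : MeromorphicAt f 0} {hg : MeromorphicAt g 0}

lemma exists_eq_mk (x : MeromorphicGerm) : ∃ f hf, x = mk f hf := by
  obtain ⟨_, f, hf, rfl⟩ := x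
  exact ⟨f, hf, rfl⟩

lemma mk_eq_mk : mk f hf = mk g hg ↔ f =ᶠ[𝓝[≠] 0] g :=
  Subtype.ext_iff.trans Germ.coe_eq

lemma mk_add_mk : mk f hf + mk g hg = mk (fun t => f t + g t) (hf.add hg) := rfl

lemma mk_mul_mk : mk f hf * mk g hg = mk (fun t => f t * g t) (hf.mul hg) := rfl

lemma mk_eq_zero : mk f hf = 0 ↔ ∀ᶠ t in 𝓝[≠] 0, f t = 0 :=
  mk_eq_mk (hg := MeromorphicAt.const 0 0)

lemma mk_ne_zero_of_ne (h : ∀ᶠ t in 𝓝[≠] 0, f t ≠ 0) : mk f hf ≠ 0 := by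
  rw [Ne, mk_eq_zero]
  intro h0
  obtain ⟨t, ht, ht'⟩ := (h.and h0).exists
  exact ht ht'

lemma isField : IsField MeromorphicGerm where
  exists_pair_ne := ⟨0, 1, fun h =>
    mk_ne_zero_of_ne (hf := MeromorphicAt.const 1 0) (by simp) h.symm⟩
  mul_comm := mul_comm
  mul_inv_cancel := by
    intro x hx
    obtain ⟨f, hf, rfl⟩ := exists_eq_mk x
    refine ⟨mk _ hf.inv, ?_⟩
    rw [mk_mul_mk]
    refine mk_eq_mk (hg := MeromorphicAt.const 1 0).2 ?_
    rcases hf.eventually_eq_zero_or_eventually_ne_zero with h | h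
    · exact absurd (mk_eq_zero.2 h) hx
    · filter_upwards [h] with t ht
      exact mul_inv_cancel₀ ht

noncomputable instance : Field MeromorphicGerm := isField.toField

/-- The derivative of a meromorphic germ. -/
noncomputable def derivative (x : MeromorphicGerm) : MeromorphicGerm :=
  mk (deriv (exists_eq_mk x).choose) (exists_eq_mk x).choose_spec.choose.deriv

lemma derivative_mk : derivative (mk f hf) = mk (deriv f) hf.deriv := by
  refine mk_eq_mk.2 ?_
  have h := mk_eq_mk.1 (exists_eq_mk (mk f hf)).choose_spec.choose_spec
  have h' := (eventually_eventually_nhdsWithin.2 h)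
  filter_upwards [h', self_mem_nhdsWithin] with t ht ht0
  refine EventuallyEq.deriv_eq ?_
  rw [isOpen_compl_singleton.nhdsWithin_eq ht0] at ht
  exact ht.mono fun _ h => h.symm

noncomputable instance : Differential MeromorphicGerm where
  deriv := Derivation.mk'
    { toFun := derivative
      map_add' := by
        intro x y
        obtain ⟨f, hf, rfl⟩ := exists_eq_mk x
        obtain ⟨g, hg, rfl⟩ := exists_eq_mk y
        rw [mk_add_mk, derivative_mk, derivative_mk, derivative_mk, mk_add_mk, mk_eq_mk]
        filter_upwards [hf.eventually_analyticAt, hg.eventually_analyticAt] with t h1 h2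
        exact deriv_fun_add h1.differentiableAt h2.differentiableAt
      map_smul' := by
        intro n x
        obtain ⟨f, hf, rfl⟩ := exists_eq_mk x
        have h1 (g : ℂ → ℂ) (hg : MeromorphicAt g 0) : n • mk g hg =
            mk (fun t => (n : ℂ) * g t) ((MeromorphicAt.const (n : ℂ) 0).mul hg) := by
          rw [zsmul_eq_mul]
          rfl
        rw [h1, derivative_mk, derivative_mk, RingHom.id_apply, h1, mk_eq_mk]
        filter_upwards with t
        exact deriv_const_mul_field (n : ℂ) }
    (by
      intro x y
      obtain ⟨f, hf, rfl⟩ := exists_eq_mk x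
      obtain ⟨g, hg, rfl⟩ := exists_eq_mk y
      change derivative (_ * _) = _ * derivative _ + _ * derivative _
      rw [mk_mul_mk, derivative_mk, derivative_mk, derivative_mk, mk_mul_mk, mk_mul_mk, mk_add_mk,
        mk_eq_mk]
      filter_upwards [hf.eventually_analyticAt, hg.eventually_analyticAt] with t h1 h2
      rw [deriv_fun_mul h1.differentiableAt h2.differentiableAt]
      ring)

lemma deriv_mk : (mk f hf)′ = mk (deriv f) hf.deriv := derivative_mk

/-- The constant germs. -/
noncomputable def const : ℂ →+* MeromorphicGerm where
  toFun c := mk (fun _ => c) (MeromorphicAt.const c 0)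
  map_one' := rfl
  map_mul' _ _ := rfl
  map_zero' := rfl
  map_add' _ _ := rfl

noncomputable instance : Algebra ℂ MeromorphicGerm := const.toAlgebra

lemma algebraMap_eq_mk (c : ℂ) :
    algebraMap ℂ MeromorphicGerm c = mk (fun _ => c) (MeromorphicAt.const c 0) := rfl

lemma deriv_algebraMap (c : ℂ) : (algebraMap ℂ MeromorphicGerm c)′ = 0 := by
  rw [algebraMap_eq_mk, deriv_mk, mk_eq_zero]
  simp

lemma logDeriv_mk : Differential.logDeriv (mk f hf) = mk (logDeriv f) hf.logDeriv := by
  rw [Differential.logDeriv, deriv_mk]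
  rcases hf.eventually_eq_zero_or_eventually_ne_zero with h | h
  · rw [mk_eq_zero.2 h, div_zero, eq_comm, mk_eq_zero]
    filter_upwards [h] with t ht
    rw [logDeriv_apply, ht, div_zero]
  · rw [div_eq_iff (mk_ne_zero_of_ne h), mk_mul_mk, mk_eq_mk]
    filter_upwards [h] with t ht
    rw [logDeriv_apply, div_mul_cancel₀ _ ht]

lemma aeval_mk (hf : MeromorphicAt f 0) (p : ℂ[X]) :
    ∃ hp, aeval (mk f hf) p = mk (fun t => p.eval (f t)) hp := by
  induction p using Polynomial.induction_on' with
  | add p q h1 h2 =>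
    obtain ⟨h1, e1⟩ := h1
    obtain ⟨h2, e2⟩ := h2
    simp only [map_add, e1, e2, eval_add]
    exact ⟨h1.add h2, rfl⟩
  | monomial n c =>
    simp only [aeval_monomial, eval_monomial]
    refine ⟨(MeromorphicAt.const c 0).mul (hf.pow n), ?_⟩
    have : mk f hf ^ n = mk (f ^ n) (hf.pow n) := rfl
    rw [this]
    rfl

/-- The germ of the identity. -/
noncomputable def z : MeromorphicGerm := mk id (MeromorphicAt.id 0)

lemma deriv_z : z′ = 1 := by
  rw [z, deriv_mk]
  refine mk_eq_mk (hg := MeromorphicAt.const 1 0).2 ?_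
  filter_upwards with t
  exact deriv_id t

lemma transcendental_z : Transcendental ℂ z :=
  transcendental_of_deriv_ne_zero deriv_algebraMap (by rw [deriv_z]; exact one_ne_zero)

/-- A germ satisfying a nontrivial polynomial equation is algebraic over the rational functions. -/
lemma isAlgebraic_mk (hf : MeromorphicAt f 0) {q : ℂ[X][X]} (hq : q ≠ 0)
    (h : ∀ᶠ t in 𝓝[≠] 0, q.evalEval t (f t) = 0) : IsAlgebraic ℂ⟮z⟯ (mk f hf) := by
  let φ : ℂ[X] →ₐ[ℂ] ℂ⟮z⟯ := aeval (AdjoinSimple.gen ℂ z)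
  have hφ (p : ℂ[X]) : algebraMap ℂ⟮z⟯ MeromorphicGerm (φ p) = aeval z p := by
    rw [← aeval_algebraMap_apply, AdjoinSimple.algebraMap_gen]
  have hinj : Function.Injective φ := by
    intro p p' hp
    apply transcendental_iff_injective.1 transcendental_z
    rw [← hφ, ← hφ, hp]
  have key (q : ℂ[X][X]) : ∃ h, aeval (mk f hf) (q.map (φ : ℂ[X] →+* ℂ⟮z⟯)) =
      mk (fun t => q.evalEval t (f t)) h := by
    induction q using Polynomial.induction_on' with
    | add p q h1 h2 =>
      obtain ⟨h1, e1⟩ := h1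
      obtain ⟨h2, e2⟩ := h2
      simp only [Polynomial.map_add, map_add, e1, e2, evalEval_add]
      exact ⟨h1.add h2, rfl⟩
    | monomial n c =>
      obtain ⟨h1, e1⟩ := aeval_mk (MeromorphicAt.id 0) c
      have : (fun t => (monomial n c).evalEval t (f t)) = fun t => c.eval t * f t ^ n := by
        ext t
        simp [evalEval, eval_monomial]
      rw [this, map_monomial, aeval_monomial]
      refine ⟨h1.mul (hf.pow n), ?_⟩
      have : mk f hf ^ n = mk (f ^ n) (hf.pow n) := rfl
      rw [this, RingHom.coe_coe, hφ, z, e1]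
      rfl
  refine ⟨q.map (φ : ℂ[X] →+* ℂ⟮z⟯), (Polynomial.map_ne_zero_iff hinj).2 hq, ?_⟩
  obtain ⟨h', e⟩ := key q
  rw [e, mk_eq_zero]
  exact h

end MeromorphicGerm

namespace MeromorphicGerm

lemma sum_mk {ι : Type*} (s : Finset ι) (c : ι → ℂ) {v : ι → ℂ → ℂ}
    (hv : ∀ j, MeromorphicAt (v j) 0) :
    ∃ h, ∑ j ∈ s, algebraMap ℂ MeromorphicGerm (c j) * mk (v j) (hv j) =
      mk (fun t => ∑ j ∈ s, c j * v j t) h := by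
  classical
  induction s using Finset.induction_on with
  | empty => exact ⟨MeromorphicAt.const 0 0, rfl⟩
  | insert j s hj ih =>
    obtain ⟨h, e⟩ := ih
    simp only [Finset.sum_insert hj, e]
    exact ⟨((MeromorphicAt.const (c j) 0).mul (hv j)).add h, rfl⟩

lemma logDeriv_mk_cexp {v : ℂ → ℂ} (hv : AnalyticAt ℂ v 0) :
    Differential.logDeriv (mk (fun t => Complex.exp (v t)) hv.cexp.meromorphicAt) =
      (mk v hv.meromorphicAt)′ := by
  rw [logDeriv_mk, deriv_mk, mk_eq_mk]
  filter_upwards [hv.meromorphicAt.eventually_analyticAt] with t ht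
  rw [logDeriv_apply, deriv_cexp ht.differentiableAt,
    mul_div_cancel_left₀ _ (Complex.exp_ne_zero _)]

lemma mk_cexp_ne_zero {v : ℂ → ℂ} (hv : MeromorphicAt (fun t => Complex.exp (v t)) 0) :
    mk (fun t => Complex.exp (v t)) hv ≠ 0 :=
  mk_ne_zero_of_ne (Eventually.of_forall fun _ => Complex.exp_ne_zero _)

/-- A complex linear combination of logarithms of algebraic functions has its derivative in the
span of the logarithmic derivatives of algebraic functions. -/
lemma deriv_mk_sum_mem_span {ι : Type*} [Fintype ι] (c : ι → ℂ) {v : ι → ℂ → ℂ}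
    (hv : ∀ j, AnalyticAt ℂ (v j) 0)
    (halg : ∀ j, ∃ q : ℂ[X][X], q ≠ 0 ∧
      ∀ᶠ t in 𝓝[≠] 0, q.evalEval t (Complex.exp (v j t)) = 0)
    (h : MeromorphicAt (fun t => ∑ j, c j * v j t) 0) :
    (mk (fun t => ∑ j, c j * v j t) h)′ ∈ Submodule.span ℂ
      (Differential.logDeriv '' {f : MeromorphicGerm | IsAlgebraic ℂ⟮z⟯ f}) := by
  obtain ⟨_, e⟩ := sum_mk Finset.univ c fun j => (hv j).meromorphicAt
  rw [← e, map_sum]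
  refine sum_mem fun j _ => ?_
  rw [Derivation.leibniz, deriv_algebraMap, smul_zero, add_zero, smul_eq_mul, ← Algebra.smul_def,
    ← logDeriv_mk_cexp (hv j)]
  obtain ⟨q, hq, hq'⟩ := halg j
  exact Submodule.smul_mem _ _ (Submodule.subset_span ⟨_, isAlgebraic_mk _ hq hq', rfl⟩)

end MeromorphicGerm

open MeromorphicGerm in
/-- The one-variable local form: an identity `P(A) B / Q(A) = exp (exp (μ v))`, with `A`, `B`
products of complex powers of algebraic functions and `exp v` algebraic, forces `v` to be locally
constant. -/
lemma eventually_deriv_eq_zero_of_aeval_mul_eq_exp_exp {ι₁ ι₂ : Type*} [Fintype ι₁] [Fintype ι₂]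
    {v : ℂ → ℂ} {v₁ : ι₁ → ℂ → ℂ} {v₂ : ι₂ → ℂ → ℂ} {μ : ℂ} (c₁ : ι₁ → ℂ) (c₂ : ι₂ → ℂ)
    (hμ : μ ≠ 0) (hv : AnalyticAt ℂ v 0) (hv₁ : ∀ j, AnalyticAt ℂ (v₁ j) 0)
    (hv₂ : ∀ j, AnalyticAt ℂ (v₂ j) 0)
    (halg : ∃ q : ℂ[X][X], q ≠ 0 ∧ ∀ᶠ t in 𝓝[≠] 0, q.evalEval t (Complex.exp (v t)) = 0)
    (halg₁ : ∀ j, ∃ q : ℂ[X][X], q ≠ 0 ∧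
      ∀ᶠ t in 𝓝[≠] 0, q.evalEval t (Complex.exp (v₁ j t)) = 0)
    (halg₂ : ∀ j, ∃ q : ℂ[X][X], q ≠ 0 ∧
      ∀ᶠ t in 𝓝[≠] 0, q.evalEval t (Complex.exp (v₂ j t)) = 0)
    (P Q : ℂ[X]) (hQ : ∀ᶠ t in 𝓝[≠] 0, Q.eval (Complex.exp (∑ j, c₁ j * v₁ j t)) ≠ 0)
    (heq : ∀ᶠ t in 𝓝[≠] 0, P.eval (Complex.exp (∑ j, c₁ j * v₁ j t)) *
      Complex.exp (∑ j, c₂ j * v₂ j t) =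
        Complex.exp (Complex.exp (μ * v t)) * Q.eval (Complex.exp (∑ j, c₁ j * v₁ j t))) :
    ∀ᶠ t in 𝓝[≠] 0, deriv v t = 0 := by
  have hw₁ : AnalyticAt ℂ (fun t => ∑ j, c₁ j * v₁ j t) 0 :=
    Finset.analyticAt_fun_sum _ fun j _ => analyticAt_const.mul (hv₁ j)
  have hw₂ : AnalyticAt ℂ (fun t => ∑ j, c₂ j * v₂ j t) 0 :=
    Finset.analyticAt_fun_sum _ fun j _ => analyticAt_const.mul (hv₂ j)
  have hw : AnalyticAt ℂ (fun t => μ * v t) 0 := analyticAt_const.mul hv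
  have haspan : (mk _ hw.meromorphicAt)′ ∈ Submodule.span ℂ
      (Differential.logDeriv '' {f : MeromorphicGerm | IsAlgebraic ℂ⟮z⟯ f}) := by
    have := deriv_mk_sum_mem_span (fun _ : Unit => μ) (v := fun _ => v) (fun _ => hv)
      (fun _ => halg) (by simpa using hw.meromorphicAt)
    simpa using this
  have hah := logDeriv_mk_cexp hw
  rw [Differential.logDeriv, div_eq_iff (mk_cexp_ne_zero _)] at hah
  obtain ⟨hPm, hP⟩ := aeval_mk
    (f := fun t => Complex.exp (∑ j, c₁ j * v₁ j t)) hw₁.cexp.meromorphicAt P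
  obtain ⟨hQm, hQ'⟩ := aeval_mk
    (f := fun t => Complex.exp (∑ j, c₁ j * v₁ j t)) hw₁.cexp.meromorphicAt Q
  have hzero := deriv_eq_zero_of_aeval_mul_eq_exp_mul deriv_algebraMap deriv_z haspan hah
    (mk_cexp_ne_zero hw₁.cexp.meromorphicAt) (mk_cexp_ne_zero hw₂.cexp.meromorphicAt)
    (mk_cexp_ne_zero hw.cexp.cexp.meromorphicAt)
    (by rw [logDeriv_mk_cexp hw₁]; exact deriv_mk_sum_mem_span c₁ hv₁ halg₁ _)
    (by rw [logDeriv_mk_cexp hw₂]; exact deriv_mk_sum_mem_span c₂ hv₂ halg₂ _)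
    (logDeriv_mk_cexp hw.cexp) (P := P) (Q := Q)
    (by rw [hQ']; exact mk_ne_zero_of_ne hQ)
    (by rw [hP, hQ', mk_mul_mk, mk_mul_mk, mk_eq_mk]; exact heq)
  rw [hah, mul_eq_zero, or_iff_left (mk_cexp_ne_zero _), deriv_mk, mk_eq_zero] at hzero
  filter_upwards [hzero] with t ht
  rw [deriv_const_mul_field] at ht
  exact (mul_eq_zero.1 ht).resolve_left hμ

/-- Finitely many nonzero polynomials have a common nonvanishing point over any ball. -/
lemma exists_mem_ball_forall_eval_ne_zero {σ ι : Type*} [Fintype σ] [Fintype ι]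
    {p : ι → MvPolynomial (σ ⊕ Unit) ℂ} (hp : ∀ i, p i ≠ 0) (ξ₀ : σ → ℂ) {r : ℝ} (hr : 0 < r) :
    ∃ ξ ∈ Metric.ball ξ₀ r, ∃ y, ∀ i, MvPolynomial.eval (Sum.elim ξ fun _ => y) (p i) ≠ 0 := by
  by_contra! h
  refine Finset.prod_ne_zero_iff.2 (fun i (_ : i ∈ Finset.univ) => hp i) ?_
  refine MvPolynomial.funext_set (Sum.elim (fun i => Metric.ball (ξ₀ i) r) fun _ => Set.univ) ?_ ?_
  · rintro (i | _)
    · exact infinite_of_mem_nhds (ξ₀ i) (Metric.ball_mem_nhds _ hr)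
    · exact Set.infinite_univ
  · intro x hx
    have hx' : x = Sum.elim (fun i => x (Sum.inl i)) fun _ => x (Sum.inr ()) := by
      ext (i | _) <;> rfl
    obtain ⟨i, hi⟩ := h (fun i => x (Sum.inl i)) (by
      rw [ball_pi _ hr]
      exact fun i _ => hx (Sum.inl i) trivial) (x (Sum.inr ()))
    rw [map_prod, map_zero]
    refine Finset.prod_eq_zero (Finset.mem_univ i) ?_
    rw [hx']
    exact hi

/-- The restriction of a polynomial to a parametrized line. -/
lemma exists_evalEval_eq_eval_line {σ : Type*} (p : MvPolynomial (σ ⊕ Unit) ℂ) (ξ v : σ → ℂ) :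
    ∃ q : ℂ[X][X], ∀ t y, q.evalEval t y =
      MvPolynomial.eval (Sum.elim (ξ + t • v) fun _ => y) p := by
  refine ⟨MvPolynomial.eval₂ (C.comp C)
    (Sum.elim (fun i => C (C (ξ i) + X * C (v i))) fun _ => X) p, fun t y => ?_⟩
  rw [← coe_evalEvalRingHom, MvPolynomial.hom_eval₂, MvPolynomial.eval, MvPolynomial.coe_eval₂Hom]
  congr 1
  · ext; simp
  · ext (i | _) <;> simp [mul_comm t]

section

variable {σ ι₁ ι₂ : Type*} [Fintype σ] [Fintype ι₁] [Fintype ι₂]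
  {u : (σ → ℂ) → ℂ} {u₁ : ι₁ → (σ → ℂ) → ℂ} {u₂ : ι₂ → (σ → ℂ) → ℂ} {μ : ℂ}

/-- The local form on a ball: the identity `P(A) B / Q(A) = exp (exp (μ u))` forces `u` to be
constant. -/
lemma exists_forall_mem_ball_eq_of_aeval_mul_eq_exp_exp (c₁ : ι₁ → ℂ) (c₂ : ι₂ → ℂ) (hμ : μ ≠ 0)
    {ξ₀ : σ → ℂ} {r : ℝ} (hr : 0 < r) (hu : DifferentiableOn ℂ u (Metric.ball ξ₀ r))
    (hu₁ : ∀ j, DifferentiableOn ℂ (u₁ j) (Metric.ball ξ₀ r))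
    (hu₂ : ∀ j, DifferentiableOn ℂ (u₂ j) (Metric.ball ξ₀ r))
    (halg : ∃ p : MvPolynomial (σ ⊕ Unit) ℂ, p ≠ 0 ∧ ∀ ξ ∈ Metric.ball ξ₀ r,
      MvPolynomial.eval (Sum.elim ξ fun _ => Complex.exp (u ξ)) p = 0)
    (halg₁ : ∀ j, ∃ p : MvPolynomial (σ ⊕ Unit) ℂ, p ≠ 0 ∧ ∀ ξ ∈ Metric.ball ξ₀ r,
      MvPolynomial.eval (Sum.elim ξ fun _ => Complex.exp (u₁ j ξ)) p = 0)
    (halg₂ : ∀ j, ∃ p : MvPolynomial (σ ⊕ Unit) ℂ, p ≠ 0 ∧ ∀ ξ ∈ Metric.ball ξ₀ r,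
      MvPolynomial.eval (Sum.elim ξ fun _ => Complex.exp (u₂ j ξ)) p = 0)
    (P Q : ℂ[X])
    (hQ : ∀ ξ ∈ Metric.ball ξ₀ r, Q.eval (Complex.exp (∑ j, c₁ j * u₁ j ξ)) ≠ 0)
    (heq : ∀ ξ ∈ Metric.ball ξ₀ r, P.eval (Complex.exp (∑ j, c₁ j * u₁ j ξ)) *
      Complex.exp (∑ j, c₂ j * u₂ j ξ) =
        Complex.exp (Complex.exp (μ * u ξ)) * Q.eval (Complex.exp (∑ j, c₁ j * u₁ j ξ))) :
    ∃ c, ∀ ξ ∈ Metric.ball ξ₀ r, u ξ = c := by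
  obtain ⟨p, hp, hpu⟩ := halg
  choose p₁ hp₁ hpu₁ using halg₁
  choose p₂ hp₂ hpu₂ using halg₂
  obtain ⟨ξ, hξ, y, hy⟩ := exists_mem_ball_forall_eval_ne_zero
    (p := fun o : Option (ι₁ ⊕ ι₂) => o.elim p (Sum.elim p₁ p₂))
    (by rintro (_ | j | j); exacts [hp, hp₁ j, hp₂ j]) ξ₀ hr
  refine ⟨u ξ, fun η hη => ?_⟩
  let γ : ℂ → σ → ℂ := fun t => ξ + t • (η - ξ)
  have hγ : Differentiable ℂ γ := by fun_prop
  let W : Set ℂ := γ ⁻¹' Metric.ball ξ₀ r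
  have hWo : IsOpen W := Metric.isOpen_ball.preimage hγ.continuous
  have hWc : IsPreconnected W := by
    refine Convex.isPreconnected ?_
    intro s hs t ht a b ha hb hab
    have : γ (a • s + b • t) = a • γ s + b • γ t := by
      have hab' : (b : ℂ) = 1 - a := by
        rw [eq_sub_iff_add_eq', ← Complex.ofReal_add, hab, Complex.ofReal_one]
      ext i
      simp only [γ, Pi.add_apply, Pi.smul_apply, Pi.sub_apply, Complex.real_smul, smul_eq_mul, hab']
      ring
    rw [Set.mem_preimage, this]
    exact convex_ball ξ₀ r hs ht ha hb hab
  have h0 : (0 : ℂ) ∈ W := by simpa [W, γ] using hξ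
  have h1 : (1 : ℂ) ∈ W := by simpa [W, γ] using hη
  have hW0 : ∀ᶠ t in 𝓝[≠] (0 : ℂ), γ t ∈ Metric.ball ξ₀ r :=
    nhdsWithin_le_nhds (hWo.mem_nhds h0)
  have hdiff {w : (σ → ℂ) → ℂ} (hw : DifferentiableOn ℂ w (Metric.ball ξ₀ r)) :
      DifferentiableOn ℂ (fun t => w (γ t)) W :=
    hw.comp hγ.differentiableOn fun _ h => h
  have han {w : (σ → ℂ) → ℂ} (hw : DifferentiableOn ℂ w (Metric.ball ξ₀ r)) :
      AnalyticOnNhd ℂ (fun t => w (γ t)) W := (hdiff hw).analyticOnNhd hWo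
  have hline (p : MvPolynomial (σ ⊕ Unit) ℂ) {w : (σ → ℂ) → ℂ}
      (hp : MvPolynomial.eval (Sum.elim ξ fun _ => y) p ≠ 0)
      (hpw : ∀ ξ ∈ Metric.ball ξ₀ r,
        MvPolynomial.eval (Sum.elim ξ fun _ => Complex.exp (w ξ)) p = 0) :
      ∃ q : ℂ[X][X], q ≠ 0 ∧ ∀ᶠ t in 𝓝[≠] 0, q.evalEval t (Complex.exp (w (γ t))) = 0 := by
    obtain ⟨q, hq⟩ := exists_evalEval_eq_eval_line p ξ (η - ξ)
    refine ⟨q, ?_, ?_⟩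
    · rintro rfl
      apply hp
      simpa [evalEval] using (hq 0 y).symm
    · filter_upwards [hW0] with t ht
      rw [hq]
      exact hpw _ ht
  have hderiv := eventually_deriv_eq_zero_of_aeval_mul_eq_exp_exp (v := fun t => u (γ t))
    (v₁ := fun j t => u₁ j (γ t)) (v₂ := fun j t => u₂ j (γ t)) c₁ c₂ hμ
    (han hu 0 h0) (fun j => han (hu₁ j) 0 h0) (fun j => han (hu₂ j) 0 h0)
    (hline p (hy none) hpu) (fun j => hline (p₁ j) (hy (some (Sum.inl j))) (hpu₁ j))
    (fun j => hline (p₂ j) (hy (some (Sum.inr j))) (hpu₂ j)) P Q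
    (hW0.mono fun t ht => hQ _ ht) (hW0.mono fun t ht => heq _ ht)
  have hzero := (han hu).deriv.eqOn_zero_of_preconnected_of_frequently_eq_zero hWc h0
    hderiv.frequently
  simpa [γ] using hWo.is_const_of_deriv_eq_zero hWc (hdiff hu) hzero h1 h0

end

end

/-- Lemma 2.6, case (10): if `R(∏_{j≤κ₁} H_j^{μ_j}) · ∏_{j>κ₁} H_j^{μ_j} = exp{H^μ}`
on a connected open set `V ⊆ ℂ^k`, where `H, H₁, …, H_{κ₁+κ₂}` are nowhere vanishing
Nash algebraic holomorphic functions with chosen holomorphic logarithms `u, u₁, …`,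
`μ, μ₁, …` are non-zero reals and `R = P/Q` is a real rational function, then `H` is constant. -/
theorem lemma26_case10
    {k κ₁ κ₂ : ℕ} (V : Set (Fin k → ℂ)) (hVo : IsOpen V) (hVc : IsConnected V)
    (H : (Fin k → ℂ) → ℂ) (Hs : Fin (κ₁ + κ₂) → (Fin k → ℂ) → ℂ)
    (u : (Fin k → ℂ) → ℂ) (us : Fin (κ₁ + κ₂) → (Fin k → ℂ) → ℂ)
    (hH : DifferentiableOn ℂ H V) (hHs : ∀ j, DifferentiableOn ℂ (Hs j) V)
    (hHn : NashAlgebraicOn H V) (hHsn : ∀ j, NashAlgebraicOn (Hs j) V)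
    (hHne : ∀ ξ ∈ V, H ξ ≠ 0) (hHsne : ∀ j, ∀ ξ ∈ V, Hs j ξ ≠ 0)
    (hu : DifferentiableOn ℂ u V) (hus : ∀ j, DifferentiableOn ℂ (us j) V)
    (hexpu : ∀ ξ ∈ V, Complex.exp (u ξ) = H ξ)
    (hexpus : ∀ j, ∀ ξ ∈ V, Complex.exp (us j ξ) = Hs j ξ)
    (μ : ℝ) (μs : Fin (κ₁ + κ₂) → ℝ) (hμ : μ ≠ 0) (hμs : ∀ j, μs j ≠ 0)
    (P Q : Polynomial ℝ)
    (A B : (Fin k → ℂ) → ℂ)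
    (hA : ∀ ξ, A ξ =
      Complex.exp (∑ j : Fin κ₁, (μs (Fin.castAdd κ₂ j) : ℂ) * us (Fin.castAdd κ₂ j) ξ))
    (hB : ∀ ξ, B ξ =
      Complex.exp (∑ j : Fin κ₂, (μs (Fin.natAdd κ₁ j) : ℂ) * us (Fin.natAdd κ₁ j) ξ))
    (hQA : ∀ ξ ∈ V, Polynomial.aeval (A ξ) Q ≠ 0)
    (heq : ∀ ξ ∈ V,
      Polynomial.aeval (A ξ) P * B ξ / Polynomial.aeval (A ξ) Q =
        Complex.exp (Complex.exp ((μ : ℂ) * u ξ))) :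
    ∃ c : ℂ, ∀ ξ ∈ V, H ξ = c := by
  refine hVo.exists_is_const_of_fderiv_eq_zero (𝕜 := ℂ) hVc.isPreconnected hH fun ξ₀ hξ₀ => ?_
  obtain ⟨r, hr, hrV⟩ := Metric.isOpen_iff.1 hVo ξ₀ hξ₀
  have hNash {F w : (Fin k → ℂ) → ℂ} (hF : NashAlgebraicOn F V)
      (hexp : ∀ ξ ∈ V, Complex.exp (w ξ) = F ξ) :
      ∃ p : MvPolynomial (Fin k ⊕ Unit) ℂ, p ≠ 0 ∧ ∀ ξ ∈ Metric.ball ξ₀ r,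
        MvPolynomial.eval (Sum.elim ξ fun _ => Complex.exp (w ξ)) p = 0 := by
    obtain ⟨p, hp, hpF⟩ := hF
    exact ⟨p, hp, fun ξ hξ => by rw [hexp ξ (hrV hξ)]; exact hpF ξ (hrV hξ)⟩
  have heval (p : Polynomial ℝ) (ξ : Fin k → ℂ) : (p.map (algebraMap ℝ ℂ)).eval (Complex.exp
      (∑ j : Fin κ₁, (μs (Fin.castAdd κ₂ j) : ℂ) * us (Fin.castAdd κ₂ j) ξ)) =
      Polynomial.aeval (A ξ) p := by
    rw [← hA, Polynomial.eval_map_algebraMap]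
  obtain ⟨c, hc⟩ := exists_forall_mem_ball_eq_of_aeval_mul_eq_exp_exp
    (fun j => (μs (Fin.castAdd κ₂ j) : ℂ)) (fun j => (μs (Fin.natAdd κ₁ j) : ℂ))
    (Complex.ofReal_ne_zero.2 hμ) hr (hu.mono hrV)
    (fun j => (hus (Fin.castAdd κ₂ j)).mono hrV) (fun j => (hus (Fin.natAdd κ₁ j)).mono hrV)
    (hNash hHn hexpu) (fun j => hNash (hHsn _) (hexpus (Fin.castAdd κ₂ j)))
    (fun j => hNash (hHsn _) (hexpus (Fin.natAdd κ₁ j)))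
    (P.map (algebraMap ℝ ℂ)) (Q.map (algebraMap ℝ ℂ))
    (fun ξ hξ => by rw [heval]; exact hQA ξ (hrV hξ))
    (fun ξ hξ => by
      rw [heval, heval, ← hB, ← heq ξ (hrV hξ), div_mul_cancel₀ _ (hQA ξ (hrV hξ))])
  have hconst : Filter.EventuallyEq (nhds ξ₀) H fun _ => Complex.exp c := by
    filter_upwards [Metric.ball_mem_nhds ξ₀ hr] with ξ hξ
    rw [← hexpu ξ (hrV hξ), hc ξ hξ]
  rw [hconst.fderiv_eq]
  simp
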